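/- arXiv:1603.05775 — 2 statements merged into one kernel-verified Lean document; each statement's English description precedes it below -/
import Mathlib

section
/- Let Δ ≥ 0, C > 0, and R ≥ C be real numbers. Define the cumulative consumption count cons(t) = ⌊C·t⌋ + 1 for t ≥ 0 (the system dequeues one sample at each time k/C, k = 0, 1, 2, …), and the cumulative production count prod(t) = 0 for 0 ≤ t < Δ and prod(t) = ⌊R·(t − Δ)⌋ + 1 for t ≥ Δ (the application enqueues one sample at each time Δ + j/R, j = 0, 1, 2, …). Then for every real t ≥ 0, cons(t) ≤ ⌈C·Δ⌉ + prod(t). (An output buffer initially holding ⌈MaxInterval × ThrConst⌉ samples never underflows, which is the sufficiency direction of the Output Buffer Size theorem.) -/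
/-- An output buffer initially holding `⌈C·Δ⌉` samples never underflows:
the cumulative consumption count `⌊C·t⌋ + 1` never exceeds the initial
contents `⌈C·Δ⌉` plus the cumulative production count, where production
starts at time `Δ` at rate `R ≥ C`. -/
theorem output_buffer_no_underflow
    (Δ C R : ℝ) (hΔ : 0 ≤ Δ) (hC : 0 < C) (hR : C ≤ R) :
    ∀ t : ℝ, 0 ≤ t →
      (⌊C * t⌋ + 1 : ℤ) ≤ ⌈C * Δ⌉ + (if t < Δ then 0 else ⌊R * (t - Δ)⌋ + 1) := by
  intro t ht
  have h1 := Int.floor_le (C * t)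
  have h2 := Int.le_ceil (C * Δ)
  split_ifs with h
  · have h3 : C * t < C * Δ := mul_lt_mul_of_pos_left h hC
    have h4 : ((⌊C * t⌋ : ℤ) : ℝ) < ((⌈C * Δ⌉ : ℤ) : ℝ) := by linarith
    have h5 : ⌊C * t⌋ < ⌈C * Δ⌉ := by exact_mod_cast h4
    omega
  · have h3 : C * (t - Δ) ≤ R * (t - Δ) :=
      mul_le_mul_of_nonneg_right hR (by linarith)
    have h4 : ⌊C * t⌋ - ⌈C * Δ⌉ ≤ ⌊R * (t - Δ)⌋ := by
      rw [Int.le_floor]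
      push_cast
      linarith
    omega
end

section
/- Let Δ > 0 and C > 0 be real numbers, and let B be a natural number with B < ⌈C·Δ⌉. Then there exists a real t with 0 ≤ t < Δ such that ⌊C·t⌋ + 1 > B. (If the output buffer initially holds fewer than ⌈C·Δ⌉ samples, then it underflows at some time before the first sample is produced at time Δ; together with the sufficiency bound, this shows ⌈MaxInterval × ThrConst⌉ is the minimum output buffer size, as asserted by the Output Buffer Size theorem.) -/
/-- If the output buffer initially holds fewer than `⌈C·Δ⌉` samples, it
underflows at some time before the first sample is produced at time `Δ`. -/
theorem output_buffer_underflow_if_too_small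
    (Δ C : ℝ) (hΔ : 0 < Δ) (hC : 0 < C) (B : ℕ) (hB : (B : ℤ) < ⌈C * Δ⌉) :
    ∃ t : ℝ, 0 ≤ t ∧ t < Δ ∧ (⌊C * t⌋ + 1 : ℤ) > B := by
  have h : (B : ℝ) < C * Δ := by
    have := Int.lt_ceil.mp hB
    exact_mod_cast this
  refine ⟨B / C, by positivity, ?_, ?_⟩
  · rw [div_lt_iff₀ hC]
    linarith
  · rw [mul_div_cancel₀ _ hC.ne', Int.floor_natCast]
    omega
end
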